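/- Jacobian identity at the erasure-free fixed point: For a multi-edge type D-GLDPC ensemble in which every variable-node and check-node local code has minimum distance at least 2 and no encoded bit is punctured, and for every ε ∈ (0,1), the map I ↦ f(I,ε) (the EXIT recursion, a polynomial map on ℝ^{n_e}) is differentiable at I = 1 = (1,…,1), and its Jacobian matrix J(1,ε) at that point equals the matrix product P(ε)·C; that is, for all l,m ∈ E, ∂f_l/∂I_m evaluated at I = 1 equals Σ_{e∈E} P^{l,e}(ε)·C^{e,m}. -/

import Mathlib

open scoped Classical

noncomputable section

namespace MET

/-- Hamming weight of a binary vector. -/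
def hWeight {m : ℕ} (x : Fin m → ZMod 2) : ℕ :=
  (Finset.univ.filter fun i => x i ≠ 0).card

/-- The row space of `G` (the local code) has minimum Hamming weight at least 2. -/
def HasMinDistGE2 {k q : ℕ} (G : Matrix (Fin k) (Fin q) (ZMod 2)) : Prop :=
  ∀ x : Fin k → ZMod 2, Matrix.vecMul x G ≠ 0 → 2 ≤ hWeight (Matrix.vecMul x G)

/-- The row space of `G` has minimum Hamming weight exactly 2. -/
def HasMinDistEq2 {k q : ℕ} (G : Matrix (Fin k) (Fin q) (ZMod 2)) : Prop :=
  HasMinDistGE2 G ∧ ∃ x : Fin k → ZMod 2, hWeight (Matrix.vecMul x G) = 2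

/-- The weight-2 vector supported on `{i,j}`. -/
def wt2vec {q : ℕ} (i j : Fin q) : Fin q → ZMod 2 :=
  fun r => if r = i ∨ r = j then 1 else 0

/-- Number of columns of edge type `l`. -/
def colCount {q n : ℕ} (τ : Fin q → Fin n) (l : Fin n) : ℕ :=
  (Finset.univ.filter fun j => τ j = l).card

/-- Rank of the matrix formed by the columns of `G` indexed by `A` together with the columns
of the `k × k` identity matrix indexed by `T`. -/
def colRank {k q : ℕ} (G : Matrix (Fin k) (Fin q) (ZMod 2))
    (A : Finset (Fin q)) (T : Finset (Fin k)) : ℕ :=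
  Matrix.rank (Matrix.of fun (i : Fin k) (j : {x // x ∈ A} ⊕ {x // x ∈ T}) =>
    Sum.elim (fun a => G i a.1) (fun t => if i = t.1 then (1 : ZMod 2) else 0) j)

/-- Multi-type split information function `ẽ_{g;u}` of a VN generator matrix. -/
def eTilde {n k q : ℕ} (G : Matrix (Fin k) (Fin q) (ZMod 2)) (τ : Fin q → Fin n)
    (g : Fin n → ℕ) (u : ℕ) : ℕ :=
  ∑ A ∈ Finset.univ.filter (fun A : Finset (Fin q) =>
      ∀ l, (A.filter fun j => τ j = l).card = g l),
    ∑ T ∈ Finset.univ.filter (fun T : Finset (Fin k) => T.card = u),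
      colRank G A T

/-- Multi-type information function `ẽ_g` of a CN generator matrix. -/
def eTildeC {n h s : ℕ} (G : Matrix (Fin h) (Fin s) (ZMod 2)) (τ : Fin s → Fin n)
    (g : Fin n → ℕ) : ℕ :=
  ∑ A ∈ Finset.univ.filter (fun A : Finset (Fin s) =>
      ∀ l, (A.filter fun j => τ j = l).card = g l),
    colRank G A ∅

/-- `χ_{2,u}(l,m)`: ordered pairs of distinct columns of types `l,m` supporting a weight-2
codeword generated by a weight-`u` input word. -/
def chi2 {n k q : ℕ} (G : Matrix (Fin k) (Fin q) (ZMod 2)) (τ : Fin q → Fin n)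
    (u : ℕ) (l m : Fin n) : ℕ :=
  (Finset.univ.filter fun p : Fin q × Fin q =>
    p.1 ≠ p.2 ∧ τ p.1 = l ∧ τ p.2 = m ∧
      ∃ x : Fin k → ZMod 2, hWeight x = u ∧ Matrix.vecMul x G = wt2vec p.1 p.2).card

/-- `ξ_2(l,m)`: ordered pairs of distinct coordinates of types `l,m` supporting a weight-2
codeword of the row space. -/
def xi2 {n h s : ℕ} (G : Matrix (Fin h) (Fin s) (ZMod 2)) (τ : Fin s → Fin n)
    (l m : Fin n) : ℕ :=
  (Finset.univ.filter fun p : Fin s × Fin s =>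
    p.1 ≠ p.2 ∧ τ p.1 = l ∧ τ p.2 = m ∧
      ∃ x : Fin h → ZMod 2, Matrix.vecMul x G = wt2vec p.1 p.2).card

/-- Range of the tuple `t`: `0 ≤ t l ≤ q l` for `l ≠ e` and `0 ≤ t e ≤ q e - 1`. -/
def tRange {n : ℕ} (q : Fin n → ℕ) (e : Fin n) : Finset (Fin n → ℕ) :=
  Fintype.piFinset fun l => Finset.range (if l = e then q l else q l + 1)

/-- The coefficient `a^{(γ,e)}_{t,z}` of the VN EXIT function. -/
def aVN {n k q : ℕ} (G : Matrix (Fin k) (Fin q) (ZMod 2)) (τ : Fin q → Fin n)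
    (e : Fin n) (t : Fin n → ℕ) (z : ℕ) : ℝ :=
  ((colCount τ e - t e : ℕ) : ℝ) *
      (eTilde G τ (fun l => colCount τ l - t l) (k - z) : ℝ)
    - ((t e + 1 : ℕ) : ℝ) *
      (eTilde G τ (fun l => colCount τ l - t l - (if l = e then 1 else 0)) (k - z) : ℝ)

/-- The coefficient `a^{(δ,e)}_{t}` of the CN EXIT function. -/
def aCN {n h s : ℕ} (G : Matrix (Fin h) (Fin s) (ZMod 2)) (τ : Fin s → Fin n)
    (e : Fin n) (t : Fin n → ℕ) : ℝ :=
  ((colCount τ e - t e : ℕ) : ℝ) *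
      (eTildeC G τ (fun l => colCount τ l - t l) : ℝ)
    - ((t e + 1 : ℕ) : ℝ) *
      (eTildeC G τ (fun l => colCount τ l - t l - (if l = e then 1 else 0)) : ℝ)

/-- Per-type VN EXIT function `I_{EV,e}^{(γ)}(I, ε)`. -/
def IEV {n k q : ℕ} (G : Matrix (Fin k) (Fin q) (ZMod 2)) (τ : Fin q → Fin n)
    (e : Fin n) (I : Fin n → ℝ) (ε : ℝ) : ℝ :=
  1 - (1 / (colCount τ e : ℝ)) *
    ∑ z ∈ Finset.range (k + 1), ε ^ z * (1 - ε) ^ (k - z) *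
      ∑ t ∈ tRange (colCount τ) e,
        (∏ l, (1 - I l) ^ t l * (I l) ^ (colCount τ l - t l - (if l = e then 1 else 0))) *
          aVN G τ e t z

/-- Per-type CN EXIT function `I_{EC,e}^{(δ)}(I)`. -/
def IEC {n h s : ℕ} (G : Matrix (Fin h) (Fin s) (ZMod 2)) (τ : Fin s → Fin n)
    (e : Fin n) (I : Fin n → ℝ) : ℝ :=
  1 - (1 / (colCount τ e : ℝ)) *
    ∑ t ∈ tRange (colCount τ) e,
      (∏ l, (1 - I l) ^ t l * (I l) ^ (colCount τ l - t l - (if l = e then 1 else 0))) *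
        aCN G τ e t

/-- A variable node type: a `k × q` generator matrix over `GF(2)` with a typing of its
columns by edge types (no punctured bits). -/
structure VNType (n : ℕ) where
  k : ℕ
  q : ℕ
  G : Matrix (Fin k) (Fin q) (ZMod 2)
  τ : Fin q → Fin n

/-- A check node type: an `h × s` generator matrix over `GF(2)` with a typing of its
columns by edge types. -/
structure CNType (n : ℕ) where
  h : ℕ
  s : ℕ
  G : Matrix (Fin h) (Fin s) (ZMod 2)
  τ : Fin s → Fin n

/-- The variable-node side of a MET D-GLDPC ensemble. -/
structure VNSide (n : ℕ) where
  nV : ℕ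
  vn : Fin nV → VNType n
  lam : Fin nV → Fin n → ℝ
  lam_nonneg : ∀ γ l, 0 ≤ lam γ l
  lam_sum : ∀ l, ∑ γ, lam γ l = 1
  lam_pos_iff : ∀ γ l, 0 < lam γ l ↔ 0 < colCount (vn γ).τ l

/-- The check-node side of a MET D-GLDPC ensemble. -/
structure CNSide (n : ℕ) where
  nC : ℕ
  cn : Fin nC → CNType n
  rho : Fin nC → Fin n → ℝ
  rho_nonneg : ∀ δ l, 0 ≤ rho δ l
  rho_sum : ∀ l, ∑ δ, rho δ l = 1
  rho_pos_iff : ∀ δ l, 0 < rho δ l ↔ 0 < colCount (cn δ).τ l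

/-- A MET D-GLDPC ensemble. -/
structure Ensemble (n : ℕ) extends VNSide n, CNSide n

/-- All VN local codes have full-rank generator matrix and minimum distance at least 2. -/
def VNSide.Good {n : ℕ} (V : VNSide n) : Prop :=
  ∀ γ, ((V.vn γ).G).rank = (V.vn γ).k ∧ HasMinDistGE2 (V.vn γ).G

/-- All CN local codes have full-rank generator matrix and minimum distance at least 2. -/
def CNSide.Good {n : ℕ} (C : CNSide n) : Prop :=
  ∀ δ, ((C.cn δ).G).rank = (C.cn δ).h ∧ HasMinDistGE2 (C.cn δ).G

/-- The matrix `P(ε)` with entries `P^{l,m}(ε)`. -/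
def Pmat {n : ℕ} (V : VNSide n) (ε : ℝ) : Matrix (Fin n) (Fin n) ℝ :=
  Matrix.of fun l m =>
    ∑ γ, if HasMinDistEq2 (V.vn γ).G then
      (V.lam γ l / (colCount (V.vn γ).τ l : ℝ)) *
        ∑ u ∈ Finset.Icc 1 (V.vn γ).k, (chi2 (V.vn γ).G (V.vn γ).τ u l m : ℝ) * ε ^ u
    else 0

/-- The matrix `C` with entries `C^{l,m}`. -/
def Cmat {n : ℕ} (C : CNSide n) : Matrix (Fin n) (Fin n) ℝ :=
  Matrix.of fun l m =>
    ∑ δ, if HasMinDistEq2 (C.cn δ).G then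
      (C.rho δ l / (colCount (C.cn δ).τ l : ℝ)) * (xi2 (C.cn δ).G (C.cn δ).τ l m : ℝ)
    else 0

/-- Aggregate VN EXIT function `I_{EV,e}(I,ε)`. -/
def IEVagg {n : ℕ} (V : VNSide n) (e : Fin n) (I : Fin n → ℝ) (ε : ℝ) : ℝ :=
  ∑ γ ∈ Finset.univ.filter (fun γ => 0 < V.lam γ e),
    V.lam γ e * IEV (V.vn γ).G (V.vn γ).τ e I ε

/-- Aggregate CN EXIT function `I_{EC,e}(I)`. -/
def IECagg {n : ℕ} (C : CNSide n) (e : Fin n) (I : Fin n → ℝ) : ℝ :=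
  ∑ δ ∈ Finset.univ.filter (fun δ => 0 < C.rho δ e),
    C.rho δ e * IEC (C.cn δ).G (C.cn δ).τ e I

/-- The EXIT recursion `f(·,ε)`. -/
def exitMap {n : ℕ} (E : Ensemble n) (ε : ℝ) (I : Fin n → ℝ) : Fin n → ℝ :=
  fun e => IEVagg E.toVNSide e (fun m => IECagg E.toCNSide m I) ε

/-- Local stability of the fixed point `1` of the EXIT recursion. -/
def LocallyStable {n : ℕ} (E : Ensemble n) (ε : ℝ) : Prop :=
  ∃ U : Set (Fin n → ℝ), IsOpen U ∧ (fun _ => (1 : ℝ)) ∈ U ∧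
    ∀ I ∈ U ∩ Set.Icc (fun _ => (0 : ℝ)) (fun _ => (1 : ℝ)),
      Filter.Tendsto (fun m => (exitMap E ε)^[m] I) Filter.atTop (nhds fun _ => (1 : ℝ))

/-- Spectral radius of a real square matrix: the maximum modulus of its complex
eigenvalues. -/
def specRad {m : ℕ} (A : Matrix (Fin m) (Fin m) ℝ) : ℝ :=
  (spectralRadius ℂ (A.map fun x : ℝ => (x : ℂ))).toReal



/-! ### Generic EXIT functions -/

def gE {n q : ℕ} (R : Finset (Fin q) → ℝ) (τ : Fin q → Fin n) (g : Fin n → ℕ) : ℝ :=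
  ∑ A ∈ Finset.univ.filter (fun A : Finset (Fin q) =>
      ∀ l, (A.filter fun j => τ j = l).card = g l), R A

def genA {n q : ℕ} (R : Finset (Fin q) → ℝ) (τ : Fin q → Fin n)
    (e : Fin n) (t : Fin n → ℕ) : ℝ :=
  ((colCount τ e - t e : ℕ) : ℝ) * gE R τ (fun l => colCount τ l - t l)
    - ((t e + 1 : ℕ) : ℝ) *
      gE R τ (fun l => colCount τ l - t l - (if l = e then 1 else 0))

def genExit {n q : ℕ} (R : Finset (Fin q) → ℝ) (τ : Fin q → Fin n)
    (e : Fin n) (I : Fin n → ℝ) : ℝ :=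
  1 - (1 / (colCount τ e : ℝ)) *
    ∑ t ∈ tRange (colCount τ) e,
      (∏ l, (1 - I l) ^ t l * (I l) ^ (colCount τ l - t l - (if l = e then 1 else 0))) *
        genA R τ e t

lemma IEC_eq_genExit {n h s : ℕ} (G : Matrix (Fin h) (Fin s) (ZMod 2)) (τ : Fin s → Fin n)
    (e : Fin n) (I : Fin n → ℝ) :
    IEC G τ e I = genExit (fun A => (colRank G A ∅ : ℝ)) τ e I := by
  unfold IEC genExit aCN genA eTildeC gE
  push_cast
  rfl

/-- The averaged rank function of a VN. -/
def vnR {k q : ℕ} (G : Matrix (Fin k) (Fin q) (ZMod 2)) (ε : ℝ) (A : Finset (Fin q)) : ℝ :=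
  ∑ T : Finset (Fin k), ε ^ (k - T.card) * (1 - ε) ^ T.card * (colRank G A T : ℝ)

lemma sum_z {k : ℕ} (ε : ℝ) (F : Finset (Fin k) → ℝ) :
    ∑ z ∈ Finset.range (k + 1), ε ^ z * (1 - ε) ^ (k - z) *
      ∑ T ∈ Finset.univ.filter (fun T : Finset (Fin k) => T.card = k - z), F T
    = ∑ T : Finset (Fin k), ε ^ (k - T.card) * (1 - ε) ^ T.card * F T := by
  have hc : ∀ T : Finset (Fin k), T.card ≤ k := fun T => by
    simpa using Finset.card_le_univ T
  rw [← Finset.sum_fiberwise_of_maps_to (s := Finset.univ) (t := Finset.range (k + 1))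
    (g := fun T : Finset (Fin k) => k - T.card)
    (fun T _ => by simp only [Finset.mem_range]; omega)]
  refine Finset.sum_congr rfl fun z hz => ?_
  rw [Finset.mem_range] at hz
  have : (Finset.univ.filter (fun T : Finset (Fin k) => T.card = k - z))
      = Finset.univ.filter (fun T : Finset (Fin k) => k - T.card = z) := by
    ext T
    have := hc T
    simp only [Finset.mem_filter, Finset.mem_univ, true_and]
    omega
  rw [this, Finset.mul_sum]
  refine Finset.sum_congr rfl fun T hT => ?_
  have h1 := hc T
  have h2 : k - T.card = z := (Finset.mem_filter.mp hT).2
  have h3 : k - z = T.card := by omega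
  rw [h3, h2]

lemma sum_eTilde {n k q : ℕ} (G : Matrix (Fin k) (Fin q) (ZMod 2)) (τ : Fin q → Fin n)
    (ε : ℝ) (g : Fin n → ℕ) :
    ∑ z ∈ Finset.range (k + 1), ε ^ z * (1 - ε) ^ (k - z) * (eTilde G τ g (k - z) : ℝ)
      = gE (vnR G ε) τ g := by
  unfold eTilde gE vnR
  push_cast
  simp_rw [← sum_z]
  rw [Finset.sum_comm]
  exact Finset.sum_congr rfl fun z _ => by rw [Finset.mul_sum]

lemma IEV_eq_genExit {n k q : ℕ} (G : Matrix (Fin k) (Fin q) (ZMod 2)) (τ : Fin q → Fin n)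
    (e : Fin n) (I : Fin n → ℝ) (ε : ℝ) :
    IEV G τ e I ε = genExit (vnR G ε) τ e I := by
  unfold IEV genExit
  congr 2
  simp_rw [Finset.mul_sum]
  rw [Finset.sum_comm]
  refine Finset.sum_congr rfl fun t _ => ?_
  unfold genA aVN
  rw [← sum_eTilde, ← sum_eTilde, Finset.mul_sum, Finset.mul_sum, ← Finset.sum_sub_distrib,
    Finset.mul_sum]
  exact Finset.sum_congr rfl fun z _ => by ring

/-! ### Combinatorics -/

lemma card_filter_compl {n q : ℕ} (τ : Fin q → Fin n) (B : Finset (Fin q)) (l : Fin n) :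
    (Bᶜ.filter fun j => τ j = l).card + (B.filter fun j => τ j = l).card = colCount τ l := by
  unfold colCount
  rw [add_comm, ← Finset.card_union_of_disjoint, ← Finset.filter_union, Finset.union_compl]
  exact Finset.disjoint_filter_filter disjoint_compl_right

lemma gE_compl {n q : ℕ} (R : Finset (Fin q) → ℝ) (τ : Fin q → Fin n) (g t : Fin n → ℕ)
    (h : ∀ l, g l + t l = colCount τ l) :
    gE R τ g = ∑ B ∈ Finset.univ.filter (fun B : Finset (Fin q) =>
      ∀ l, (B.filter fun j => τ j = l).card = t l), R Bᶜ := by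
  unfold gE
  refine Finset.sum_bij' (fun A _ => Aᶜ) (fun B _ => Bᶜ) ?_ ?_ ?_ ?_ ?_
  · intro A hA
    simp only [Finset.mem_filter, Finset.mem_univ, true_and] at hA ⊢
    intro l
    have := card_filter_compl τ A l
    have := hA l
    have := h l
    omega
  · intro A hA
    simp only [Finset.mem_filter, Finset.mem_univ, true_and] at hA ⊢
    intro l
    have := card_filter_compl τ A l
    have := hA l
    have := h l
    omega
  · simp
  · simp
  · simp

lemma card_filter_insert' {n q : ℕ} (τ : Fin q → Fin n) (B : Finset (Fin q)) (i : Fin q)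
    (hi : i ∉ B) (l : Fin n) :
    ((insert i B).filter fun j => τ j = l).card
      = (B.filter fun j => τ j = l).card + (if l = τ i then 1 else 0) := by
  rw [Finset.filter_insert]
  by_cases h : τ i = l
  · rw [if_pos h, if_pos h.symm, Finset.card_insert_of_notMem]
    simp [hi]
  · rw [if_neg h, if_neg (fun h' => h h'.symm), add_zero]

lemma genA_eq {n q : ℕ} (R : Finset (Fin q) → ℝ) (τ : Fin q → Fin n)
    (e : Fin n) (t : Fin n → ℕ) (ht : t ∈ tRange (colCount τ) e) :
    genA R τ e t = ∑ B ∈ Finset.univ.filter (fun B : Finset (Fin q) =>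
      ∀ l, (B.filter fun j => τ j = l).card = t l),
      ∑ i ∈ Bᶜ.filter (fun i => τ i = e), (R Bᶜ - R (insert i B)ᶜ) := by
  unfold tRange at ht
  rw [Fintype.mem_piFinset] at ht
  have ht' : ∀ l, t l + (if l = e then 1 else 0) ≤ colCount τ l := by
    intro l
    have := ht l
    rw [Finset.mem_range] at this
    split_ifs at this ⊢ <;> omega
  unfold genA
  rw [gE_compl R τ (fun l => colCount τ l - t l) t (fun l => by have := ht' l; omega),
    gE_compl R τ _ (fun l => t l + (if l = e then 1 else 0))
      (fun l => by have := ht' l; omega)]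
  simp_rw [Finset.sum_sub_distrib]
  congr 1
  · rw [Finset.mul_sum]
    refine Finset.sum_congr rfl fun B hB => ?_
    have hB := (Finset.mem_filter.mp hB).2
    rw [Finset.sum_const, nsmul_eq_mul]
    congr 2
    have := card_filter_compl τ B e
    have := hB e
    omega
  · rw [Finset.mul_sum, Finset.sum_sigma']
    have : ∀ B ∈ Finset.univ.filter (fun B : Finset (Fin q) =>
      ∀ l, (B.filter fun j => τ j = l).card = t l + (if l = e then 1 else 0)),
        ((t e + 1 : ℕ) : ℝ) * R Bᶜ = ∑ i ∈ B.filter (fun i => τ i = e), R Bᶜ := by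
      intro B hB
      have hB := (Finset.mem_filter.mp hB).2 e
      rw [Finset.sum_const, nsmul_eq_mul, hB, if_pos rfl]
    rw [Finset.sum_congr rfl this, Finset.sum_sigma']
    refine Finset.sum_bij' (fun p _ => ⟨p.1.erase p.2, p.2⟩) (fun p _ => ⟨insert p.2 p.1, p.2⟩)
      ?_ ?_ ?_ ?_ ?_
    · rintro ⟨B, i⟩ h
      simp only [Finset.mem_sigma, Finset.mem_filter, Finset.mem_univ, true_and,
        Finset.mem_compl] at h ⊢
      obtain ⟨h1, h2, h3⟩ := h
      refine ⟨fun l => ?_, by simp, h3⟩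
      have := card_filter_insert' τ (B.erase i) i (by simp) l
      rw [Finset.insert_erase h2, h1 l, h3] at this
      omega
    · rintro ⟨B, i⟩ h
      simp only [Finset.mem_sigma, Finset.mem_filter, Finset.mem_univ, true_and,
        Finset.mem_compl] at h ⊢
      obtain ⟨h1, h2, h3⟩ := h
      refine ⟨fun l => ?_, by simp, h3⟩
      rw [card_filter_insert' τ B i h2 l, h1 l, h3]
    · rintro ⟨B, i⟩ h
      simp only [Finset.mem_sigma, Finset.mem_filter] at h
      simp [Finset.insert_erase h.2.1]
    · rintro ⟨B, i⟩ h
      simp only [Finset.mem_sigma, Finset.mem_filter, Finset.mem_compl] at h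
      simp [Finset.erase_insert h.2.1]
    · rintro ⟨B, i⟩ h
      simp only [Finset.mem_sigma, Finset.mem_filter] at h
      simp [Finset.insert_erase h.2.1]

lemma filter_cnt_zero {n q : ℕ} (τ : Fin q → Fin n) :
    Finset.univ.filter (fun B : Finset (Fin q) =>
      ∀ l, (B.filter fun j => τ j = l).card = (0 : Fin n → ℕ) l) = {∅} := by
  ext B
  simp only [Finset.mem_filter, Finset.mem_univ, true_and, Finset.mem_singleton, Pi.zero_apply,
    Finset.card_eq_zero]
  constructor
  · intro h
    rw [Finset.eq_empty_iff_forall_notMem]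
    intro j hj
    have : j ∈ B.filter (fun i => τ i = τ j) := by simp [hj]
    rw [h] at this
    simp at this
  · rintro rfl
    simp

lemma filter_cnt_single {n q : ℕ} (τ : Fin q → Fin n) (m : Fin n) :
    Finset.univ.filter (fun B : Finset (Fin q) =>
      ∀ l, (B.filter fun j => τ j = l).card = (Pi.single m 1 : Fin n → ℕ) l)
      = (Finset.univ.filter (fun j => τ j = m)).image (fun j => ({j} : Finset (Fin q))) := by
  ext B
  simp only [Finset.mem_filter, Finset.mem_univ, true_and, Finset.mem_image]
  constructor
  · intro h
    have h1 := h m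
    rw [Pi.single_eq_same, Finset.card_eq_one] at h1
    obtain ⟨j, hj⟩ := h1
    have hjB : j ∈ B.filter (fun i => τ i = m) := by rw [hj]; simp
    have hjB' := Finset.mem_filter.mp hjB
    refine ⟨j, hjB'.2, ?_⟩
    symm
    rw [Finset.eq_singleton_iff_unique_mem]
    refine ⟨hjB'.1, fun i hi => ?_⟩
    have hc := h (τ i)
    have hi' : i ∈ B.filter (fun r => τ r = τ i) := by simp [hi]
    by_cases hm : τ i = m
    · rw [hm, hj] at hi'
      simpa using hi'
    · rw [Pi.single_eq_of_ne hm, Finset.card_eq_zero] at hc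
      rw [hc] at hi'
      simp at hi'
  · rintro ⟨j, hj, rfl⟩ l
    rw [Finset.filter_singleton, hj]
    by_cases h : m = l
    · subst h; simp
    · rw [if_neg h, Pi.single_eq_of_ne (fun h' => h h'.symm)]; simp

/-- Pair sum. -/
def pairSum {n q : ℕ} (D : Fin q → Fin q → ℝ) (τ : Fin q → Fin n) (e m : Fin n) : ℝ :=
  ∑ p ∈ Finset.univ.filter (fun p : Fin q × Fin q => p.1 ≠ p.2 ∧ τ p.1 = e ∧ τ p.2 = m),
    D p.1 p.2

lemma genA_zero {n q : ℕ} (R : Finset (Fin q) → ℝ) (τ : Fin q → Fin n) (e : Fin n)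
    (h1 : ∀ j, R {j}ᶜ = R Finset.univ)
    (ht : (0 : Fin n → ℕ) ∈ tRange (colCount τ) e) : genA R τ e 0 = 0 := by
  rw [genA_eq R τ e 0 ht, filter_cnt_zero, Finset.sum_singleton]
  refine Finset.sum_eq_zero fun i _ => ?_
  rw [Finset.compl_empty, insert_empty_eq, h1, sub_self]

lemma genA_single {n q : ℕ} (R : Finset (Fin q) → ℝ) (τ : Fin q → Fin n) (e m : Fin n)
    (D : Fin q → Fin q → ℝ)
    (h2 : ∀ i j, i ≠ j → R {j}ᶜ - R ({i, j} : Finset (Fin q))ᶜ = D i j)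
    (ht : (Pi.single m 1 : Fin n → ℕ) ∈ tRange (colCount τ) e) :
    genA R τ e (Pi.single m 1) = pairSum D τ e m := by
  rw [genA_eq R τ e _ ht, filter_cnt_single, Finset.sum_image (by intro a _ b _ h; simpa using h)]
  unfold pairSum
  rw [Finset.sum_sigma']
  refine Finset.sum_bij' (fun p _ => (p.2, p.1)) (fun p _ => ⟨p.2, p.1⟩) ?_ ?_ ?_ ?_ ?_
  · rintro ⟨j, i⟩ h
    simp at h ⊢
    tauto
  · rintro ⟨j, i⟩ h
    simp at h ⊢
    tauto
  · simp
  · simp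
  · rintro ⟨j, i⟩ h
    simp at h
    exact h2 i j h.2.1

lemma pairSum_eq_zero {n q : ℕ} (τ : Fin q → Fin n) (e m : Fin n)
    (D : Fin q → Fin q → ℝ)
    (ht : (Pi.single m 1 : Fin n → ℕ) ∉ tRange (colCount τ) e)
    (he : 0 < colCount τ e) :
    pairSum D τ e m = 0 := by
  unfold pairSum
  rw [Finset.sum_eq_zero]
  rintro ⟨i, j⟩ h
  exfalso
  simp only [Finset.mem_filter, Finset.mem_univ, true_and] at h
  obtain ⟨hij, hi, hj⟩ := h
  apply ht
  unfold tRange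
  rw [Fintype.mem_piFinset]
  intro l
  rw [Finset.mem_range]
  by_cases hl : l = m
  · subst hl
    rw [Pi.single_eq_same]
    split_ifs with h
    · subst h
      unfold colCount
      rw [Finset.one_lt_card]
      exact ⟨i, by simp [hi], j, by simp [hj], hij⟩
    · have : 0 < colCount τ l := Finset.card_pos.mpr ⟨j, by simp [hj]⟩
      omega
  · rw [Pi.single_eq_of_ne hl]
    split_ifs with h
    · subst h; exact he
    · omega

/-! ### Calculus -/

/-- The linear functional with coefficients `c`. -/
def lin {n : ℕ} (c : Fin n → ℝ) : (Fin n → ℝ) →L[ℝ] ℝ :=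
  ∑ m, c m • ContinuousLinearMap.proj (R := ℝ) (φ := fun _ : Fin n => ℝ) m

lemma lin_apply {n : ℕ} (c v : Fin n → ℝ) : lin c v = ∑ m, c m * v m := by
  simp [lin]

lemma hasFDerivAt_prod {n : ℕ} (t s : Fin n → ℕ) (ht : t ≠ 0) :
    HasFDerivAt (fun I : Fin n → ℝ => ∏ l, (1 - I l) ^ t l * (I l) ^ s l)
      (lin fun m => if t = Pi.single m 1 then -1 else 0) (fun _ => 1) := by
  obtain ⟨m, hm⟩ := Function.ne_iff.mp ht
  simp only [Pi.zero_apply] at hm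
  obtain ⟨a, ha⟩ := Nat.exists_eq_succ_of_ne_zero hm
  let h : (Fin n → ℝ) → ℝ := fun I => ((1 - I m) ^ a * (I m) ^ s m) *
    ∏ l ∈ Finset.univ.erase m, (1 - I l) ^ t l * (I l) ^ s l
  have hf : (fun I : Fin n → ℝ => ∏ l, (1 - I l) ^ t l * (I l) ^ s l)
      = fun I => (1 - I m) * h I := by
    funext I
    rw [← Finset.mul_prod_erase _ _ (Finset.mem_univ m), ha, pow_succ]
    simp only [h]
    ring
  have hd : DifferentiableAt ℝ h (fun _ => 1) := by
    simp only [h]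
    fun_prop
  have h1 : h (fun _ => 1) = if t = Pi.single m 1 then 1 else 0 := by
    simp only [h, sub_self, one_pow, mul_one]
    split_ifs with hts
    · have : a = 0 := by
        have := congrFun hts m
        rw [Pi.single_eq_same] at this
        omega
      rw [this, pow_zero, one_mul]
      refine Finset.prod_eq_one fun l hl => ?_
      rw [hts, Pi.single_eq_of_ne (Finset.ne_of_mem_erase hl), pow_zero]
    · by_contra hne
      apply hts
      rw [mul_eq_zero, not_or, Finset.prod_eq_zero_iff] at hne
      push Not at hne
      funext l
      by_cases hl : l = m
      · subst hl
        rw [Pi.single_eq_same, ha]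
        by_contra h0
        have : a ≠ 0 := by omega
        exact hne.1 (zero_pow this)
      · rw [Pi.single_eq_of_ne hl]
        by_contra h0
        exact hne.2 l (by simp [hl]) (zero_pow h0)
  have hp : HasFDerivAt (fun I : Fin n → ℝ => 1 - I m)
      (-(ContinuousLinearMap.proj (R := ℝ) (φ := fun _ : Fin n => ℝ) m)) (fun _ => 1) :=
    (hasFDerivAt_apply m _).const_sub 1
  rw [hf]
  have := hp.mul hd.hasFDerivAt
  refine this.congr_fderiv ?_
  ext v
  rw [h1]
  simp only [sub_self, zero_smul, zero_add, _root_.smul_apply,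
    _root_.neg_apply, ContinuousLinearMap.proj_apply, lin_apply, smul_eq_mul]
  rw [Finset.sum_eq_single m]
  · split_ifs <;> ring
  · intro b _ hb
    rw [if_neg, zero_mul]
    intro hts
    have := congrFun hts m
    rw [Pi.single_eq_of_ne hb.symm] at this
    exact hm this
  · simp

lemma genExit_hasFDerivAt {n q : ℕ} (R : Finset (Fin q) → ℝ) (τ : Fin q → Fin n) (e : Fin n)
    (D : Fin q → Fin q → ℝ)
    (h1 : ∀ j, R {j}ᶜ = R Finset.univ)
    (h2 : ∀ i j, i ≠ j → R {j}ᶜ - R ({i, j} : Finset (Fin q))ᶜ = D i j)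
    (he : 0 < colCount τ e) :
    HasFDerivAt (genExit R τ e) (lin fun m => (1 / (colCount τ e : ℝ)) * pairSum D τ e m)
      (fun _ => 1) := by
  have key : ∀ t ∈ tRange (colCount τ) e, HasFDerivAt (fun I : Fin n → ℝ =>
      (∏ l, (1 - I l) ^ t l * (I l) ^ (colCount τ l - t l - (if l = e then 1 else 0))) *
        genA R τ e t) (genA R τ e t • lin fun m => if t = Pi.single m 1 then -1 else 0)
        (fun _ => 1) := by
    intro t ht
    by_cases h0 : t = 0
    · subst h0
      rw [genA_zero R τ e h1 ht]
      simp only [mul_zero, zero_smul]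
      exact hasFDerivAt_const _ _
    · exact (hasFDerivAt_prod t _ h0).mul_const _
  have := ((HasFDerivAt.fun_sum key).const_mul (1 / (colCount τ e : ℝ))).const_sub 1
  refine this.congr_fderiv ?_
  ext v
  simp only [_root_.neg_apply, _root_.smul_apply,
    _root_.sum_apply, lin_apply, smul_eq_mul]
  have hs : ∀ m, pairSum D τ e m = ∑ t ∈ tRange (colCount τ) e,
      if t = Pi.single m 1 then genA R τ e t else 0 := by
    intro m
    rw [Finset.sum_ite_eq']
    split_ifs with h
    · exact (genA_single R τ e m D h2 h).symm
    · exact pairSum_eq_zero τ e m D h he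
  simp_rw [hs, Finset.mul_sum, Finset.sum_mul]
  rw [Finset.sum_comm, ← Finset.sum_neg_distrib]
  refine Finset.sum_congr rfl fun m _ => ?_
  rw [← Finset.sum_neg_distrib]
  refine Finset.sum_congr rfl fun t _ => ?_
  split_ifs <;> ring

lemma genExit_one {n q : ℕ} (R : Finset (Fin q) → ℝ) (τ : Fin q → Fin n) (e : Fin n)
    (h1 : ∀ j, R {j}ᶜ = R Finset.univ) :
    genExit R τ e (fun _ => 1) = 1 := by
  unfold genExit
  rw [Finset.sum_eq_zero, mul_zero, sub_zero]
  intro t ht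
  by_cases h0 : t = 0
  · subst h0
    rw [genA_zero R τ e h1 ht, mul_zero]
  · obtain ⟨m, hm⟩ := Function.ne_iff.mp h0
    rw [Finset.prod_eq_zero (Finset.mem_univ m), zero_mul]
    simp only [Pi.zero_apply] at hm
    simp [zero_pow hm]

/-! ### Ranks -/

/-- The words `x` with `x G` vanishing on `A` and `x` vanishing on `T`. -/
def kerS {k q : ℕ} (G : Matrix (Fin k) (Fin q) (ZMod 2))
    (A : Finset (Fin q)) (T : Finset (Fin k)) : Submodule (ZMod 2) (Fin k → ZMod 2) :=
  LinearMap.ker ((Matrix.of fun (i : Fin k) (j : {x // x ∈ A} ⊕ {x // x ∈ T}) =>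
    Sum.elim (fun a => G i a.1) (fun t => if i = t.1 then (1 : ZMod 2) else 0) j).transpose.mulVecLin)

lemma mem_kerS {k q : ℕ} (G : Matrix (Fin k) (Fin q) (ZMod 2))
    (A : Finset (Fin q)) (T : Finset (Fin k)) (x : Fin k → ZMod 2) :
    x ∈ kerS G A T ↔ (∀ a ∈ A, Matrix.vecMul x G a = 0) ∧ ∀ t ∈ T, x t = 0 := by
  unfold kerS
  rw [LinearMap.mem_ker, Matrix.mulVecLin_apply, Matrix.mulVec_transpose, funext_iff, Sum.forall]
  refine and_congr ?_ ?_
  · rw [Subtype.forall]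
    rfl
  · rw [Subtype.forall]
    refine forall₂_congr fun t ht => ?_
    simp [Matrix.vecMul, dotProduct]

lemma colRank_add {k q : ℕ} (G : Matrix (Fin k) (Fin q) (ZMod 2))
    (A : Finset (Fin q)) (T : Finset (Fin k)) :
    colRank G A T + Module.finrank (ZMod 2) (kerS G A T) = k := by
  unfold colRank kerS
  rw [← Matrix.rank_transpose]
  unfold Matrix.rank
  rw [LinearMap.finrank_range_add_finrank_ker]
  simp

lemma vecMul_inj {k q : ℕ} (G : Matrix (Fin k) (Fin q) (ZMod 2)) (hG : G.rank = k)
    (x : Fin k → ZMod 2) (hx : Matrix.vecMul x G = 0) : x = 0 := by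
  have h := LinearMap.finrank_range_add_finrank_ker (G.transpose.mulVecLin)
  have h2 : Module.finrank (ZMod 2) (LinearMap.range G.transpose.mulVecLin) = k := by
    exact (Matrix.rank_transpose G).trans hG
  rw [h2] at h
  simp only [Module.finrank_fin_fun, Nat.add_eq_left] at h
  rw [Submodule.finrank_eq_zero] at h
  have : x ∈ LinearMap.ker G.transpose.mulVecLin := by
    rw [LinearMap.mem_ker, Matrix.mulVecLin_apply, Matrix.mulVec_transpose, hx]
  rw [h] at this
  simpa using this

lemma colRank_univ {k q : ℕ} (G : Matrix (Fin k) (Fin q) (ZMod 2)) (hG : G.rank = k)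
    (T : Finset (Fin k)) : colRank G Finset.univ T = k := by
  have h := colRank_add G Finset.univ T
  have : kerS G Finset.univ T = ⊥ := by
    rw [eq_bot_iff]
    intro x hx
    rw [mem_kerS] at hx
    exact vecMul_inj G hG x (funext fun a => hx.1 a (Finset.mem_univ a))
  rw [this, finrank_bot] at h
  exact h

lemma hWeight_le {q : ℕ} (y : Fin q → ZMod 2) (B : Finset (Fin q)) (h : ∀ a ∈ Bᶜ, y a = 0) :
    hWeight y ≤ B.card := by
  unfold hWeight
  apply Finset.card_le_card
  intro a ha
  by_contra hB
  exact (Finset.mem_filter.mp ha).2 (h a (by simpa using hB))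

lemma colRank_single {k q : ℕ} (G : Matrix (Fin k) (Fin q) (ZMod 2)) (hG : G.rank = k)
    (hd : HasMinDistGE2 G) (j : Fin q) (T : Finset (Fin k)) : colRank G {j}ᶜ T = k := by
  have h := colRank_add G {j}ᶜ T
  have : kerS G {j}ᶜ T = ⊥ := by
    rw [eq_bot_iff]
    intro x hx
    rw [mem_kerS] at hx
    refine vecMul_inj G hG x ?_
    by_contra hne
    have h1 := hd x hne
    have h2 := hWeight_le _ {j} hx.1
    rw [Finset.card_singleton] at h2
    omega
  rw [this, finrank_bot] at h
  exact h

lemma zmod2_eq_one {a : ZMod 2} (h : a ≠ 0) : a = 1 := by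
  revert a; decide

lemma eq_wt2vec {q : ℕ} (y : Fin q → ZMod 2) (i j : Fin q)
    (h : ∀ a ∈ ({i, j} : Finset (Fin q))ᶜ, y a = 0) (h2 : 2 ≤ hWeight y) : y = wt2vec i j := by
  have hsub : (Finset.univ.filter fun r => y r ≠ 0) ⊆ {i, j} := by
    intro a ha
    by_contra hB
    exact (Finset.mem_filter.mp ha).2 (h a (by simpa using hB))
  have heq := Finset.eq_of_subset_of_card_le hsub (Finset.card_le_two.trans h2)
  funext r
  unfold wt2vec
  have hr : r ∈ (Finset.univ.filter fun r => y r ≠ 0) ↔ r ∈ ({i, j} : Finset (Fin q)) := by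
    rw [heq]
  simp only [Finset.mem_filter, Finset.mem_univ, true_and, Finset.mem_insert,
    Finset.mem_singleton] at hr
  split_ifs with hc
  · exact zmod2_eq_one (hr.mpr hc)
  · by_contra h0
    exact hc (hr.mp h0)

lemma wt2vec_ne_zero {q : ℕ} (i j : Fin q) : wt2vec i j ≠ 0 := by
  intro h
  have := congrFun h i
  simp [wt2vec] at this

lemma colRank_pair {k q : ℕ} (G : Matrix (Fin k) (Fin q) (ZMod 2)) (hG : G.rank = k)
    (hd : HasMinDistGE2 G) (i j : Fin q) (T : Finset (Fin k)) :
    (colRank G {j}ᶜ T : ℝ) - (colRank G ({i, j} : Finset (Fin q))ᶜ T : ℝ)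
      = if ∃ x, Matrix.vecMul x G = wt2vec i j ∧ ∀ t ∈ T, x t = 0 then 1 else 0 := by
  rw [colRank_single G hG hd]
  have h := colRank_add G ({i, j} : Finset (Fin q))ᶜ T
  have hcase : ∀ y ∈ kerS G ({i, j} : Finset (Fin q))ᶜ T,
      y = 0 ∨ Matrix.vecMul y G = wt2vec i j := by
    intro y hy
    rw [mem_kerS] at hy
    by_cases hne : Matrix.vecMul y G = 0
    · exact Or.inl (vecMul_inj G hG y hne)
    · exact Or.inr (eq_wt2vec _ i j hy.1 (hd y hne))
  have hfr : Module.finrank (ZMod 2) (kerS G ({i, j} : Finset (Fin q))ᶜ T)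
      = if ∃ x, Matrix.vecMul x G = wt2vec i j ∧ ∀ t ∈ T, x t = 0 then 1 else 0 := by
    split_ifs with hx
    · obtain ⟨x, hx1, hx2⟩ := hx
      have hx0 : x ≠ 0 := by
        rintro rfl
        rw [Matrix.zero_vecMul] at hx1
        exact wt2vec_ne_zero i j hx1.symm
      have : kerS G ({i, j} : Finset (Fin q))ᶜ T = Submodule.span (ZMod 2) {x} := by
        apply le_antisymm
        · intro y hy
          rcases hcase y hy with h0 | h1
          · rw [h0]; exact Submodule.zero_mem _
          · have : y - x = 0 := vecMul_inj G hG _ (by rw [Matrix.sub_vecMul, h1, hx1, sub_self])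
            rw [sub_eq_zero.mp this]
            exact Submodule.mem_span_singleton_self x
        · rw [Submodule.span_singleton_le_iff_mem, mem_kerS]
          refine ⟨fun a ha => ?_, hx2⟩
          rw [hx1]
          simp only [Finset.mem_compl, Finset.mem_insert, Finset.mem_singleton] at ha
          simp [wt2vec, ha]
      rw [this, finrank_span_singleton hx0]
    · have : kerS G ({i, j} : Finset (Fin q))ᶜ T = ⊥ := by
        rw [eq_bot_iff]
        intro y hy
        rcases hcase y hy with h0 | h1
        · exact h0
        · exact absurd ⟨y, h1, ((mem_kerS _ _ _ _).mp hy).2⟩ hx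
      rw [this, finrank_bot]
  rw [hfr] at h
  have h' : (colRank G ({i, j} : Finset (Fin q))ᶜ T : ℝ)
    + (if ∃ x, Matrix.vecMul x G = wt2vec i j ∧ ∀ t ∈ T, x t = 0 then 1 else 0) = k := by
    exact_mod_cast h
  linarith

lemma sum_T {k : ℕ} (ε : ℝ) (x : Fin k → ZMod 2) :
    ∑ T : Finset (Fin k), ε ^ (k - T.card) * (1 - ε) ^ T.card *
      (if ∀ t ∈ T, x t = 0 then (1 : ℝ) else 0) = ε ^ hWeight x := by
  simp only [mul_ite, mul_one, mul_zero]
  rw [← Finset.sum_filter]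
  set S := Finset.univ.filter (fun t => x t = 0) with hS
  have hcard : S.card + hWeight x = k := by
    have := Finset.card_filter_add_card_filter_not (s := (Finset.univ : Finset (Fin k)))
      (fun t => x t = 0)
    simpa [hWeight, hS] using this
  have hf : Finset.univ.filter (fun T : Finset (Fin k) => ∀ t ∈ T, x t = 0) = S.powerset := by
    ext T
    simp [hS, Finset.subset_iff]
  rw [hf]
  have h := Finset.sum_pow_mul_eq_add_pow (1 - ε) ε S
  rw [sub_add_cancel, one_pow] at h
  calc _ = ∑ T ∈ S.powerset, ε ^ hWeight x * ((1 - ε) ^ T.card * ε ^ (S.card - T.card)) := by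
        refine Finset.sum_congr rfl fun T hT => ?_
        have hle := Finset.card_le_card (Finset.mem_powerset.mp hT)
        have : k - T.card = hWeight x + (S.card - T.card) := by omega
        rw [this, pow_add]
        ring
    _ = _ := by rw [← Finset.mul_sum, h, mul_one]

/-- Weight of the pair `(i,j)` for a VN. -/
def vnD {k q : ℕ} (G : Matrix (Fin k) (Fin q) (ZMod 2)) (ε : ℝ) (i j : Fin q) : ℝ :=
  ∑ u ∈ Finset.Icc 1 k,
    if ∃ x : Fin k → ZMod 2, hWeight x = u ∧ Matrix.vecMul x G = wt2vec i j then ε ^ u else 0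

lemma vnR_pair {k q : ℕ} (G : Matrix (Fin k) (Fin q) (ZMod 2)) (hG : G.rank = k)
    (hd : HasMinDistGE2 G) (ε : ℝ) (i j : Fin q) :
    vnR G ε {j}ᶜ - vnR G ε ({i, j} : Finset (Fin q))ᶜ = vnD G ε i j := by
  unfold vnR vnD
  rw [← Finset.sum_sub_distrib]
  simp_rw [← mul_sub, colRank_pair G hG hd]
  by_cases hx : ∃ x, Matrix.vecMul x G = wt2vec i j
  · obtain ⟨x, hx⟩ := hx
    have huniq : ∀ y, Matrix.vecMul y G = wt2vec i j → y = x := fun y hy =>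
      sub_eq_zero.mp (vecMul_inj G hG _ (by rw [Matrix.sub_vecMul, hy, hx, sub_self]))
    have h1 : ∀ T : Finset (Fin k), (∃ x, Matrix.vecMul x G = wt2vec i j ∧ ∀ t ∈ T, x t = 0)
        ↔ ∀ t ∈ T, x t = 0 := fun T =>
      ⟨fun ⟨y, hy, hT⟩ => huniq y hy ▸ hT, fun h => ⟨x, hx, h⟩⟩
    have h2 : ∀ u, (∃ x : Fin k → ZMod 2, hWeight x = u ∧ Matrix.vecMul x G = wt2vec i j)
        ↔ u = hWeight x := fun u =>
      ⟨fun ⟨y, hu, hy⟩ => by rw [← hu, huniq y hy], fun h => ⟨x, h.symm, hx⟩⟩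
    simp_rw [h1, h2]
    rw [sum_T, Finset.sum_ite_eq', if_pos]
    rw [Finset.mem_Icc]
    constructor
    · have hx0 : x ≠ 0 := by
        rintro rfl
        rw [Matrix.zero_vecMul] at hx
        exact wt2vec_ne_zero i j hx.symm
      obtain ⟨r, hr⟩ := Function.ne_iff.mp hx0
      exact Finset.card_pos.mpr ⟨r, by simpa using hr⟩
    · simpa [hWeight] using Finset.card_le_univ (Finset.univ.filter fun i => x i ≠ 0)
  · have h1 : ∀ T : Finset (Fin k),
        ¬ (∃ x, Matrix.vecMul x G = wt2vec i j ∧ ∀ t ∈ T, x t = 0) :=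
      fun T ⟨y, hy, _⟩ => hx ⟨y, hy⟩
    have h2 : ∀ u, ¬ (∃ x : Fin k → ZMod 2, hWeight x = u ∧ Matrix.vecMul x G = wt2vec i j) :=
      fun u ⟨y, _, hy⟩ => hx ⟨y, hy⟩
    simp [h1, h2]

lemma vnR_single {k q : ℕ} (G : Matrix (Fin k) (Fin q) (ZMod 2)) (hG : G.rank = k)
    (hd : HasMinDistGE2 G) (ε : ℝ) (j : Fin q) :
    vnR G ε {j}ᶜ = vnR G ε Finset.univ := by
  unfold vnR
  simp_rw [colRank_single G hG hd, colRank_univ G hG]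

lemma pairSum_vnD {n k q : ℕ} (G : Matrix (Fin k) (Fin q) (ZMod 2)) (τ : Fin q → Fin n)
    (ε : ℝ) (l m : Fin n) :
    pairSum (vnD G ε) τ l m = ∑ u ∈ Finset.Icc 1 k, (chi2 G τ u l m : ℝ) * ε ^ u := by
  unfold pairSum vnD
  rw [Finset.sum_comm]
  refine Finset.sum_congr rfl fun u _ => ?_
  rw [← Finset.sum_filter, Finset.filter_filter, Finset.sum_const, nsmul_eq_mul]
  unfold chi2
  congr 3
  ext p
  simp only [Finset.mem_filter, and_assoc]

/-- Weight of the pair `(i,j)` for a CN. -/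
def cnD {k q : ℕ} (G : Matrix (Fin k) (Fin q) (ZMod 2)) (i j : Fin q) : ℝ :=
  if ∃ x : Fin k → ZMod 2, Matrix.vecMul x G = wt2vec i j then 1 else 0

lemma cnR_pair {k q : ℕ} (G : Matrix (Fin k) (Fin q) (ZMod 2)) (hG : G.rank = k)
    (hd : HasMinDistGE2 G) (i j : Fin q) :
    (colRank G {j}ᶜ ∅ : ℝ) - (colRank G ({i, j} : Finset (Fin q))ᶜ ∅ : ℝ) = cnD G i j := by
  rw [colRank_pair G hG hd]
  simp [cnD]

lemma pairSum_cnD {n k q : ℕ} (G : Matrix (Fin k) (Fin q) (ZMod 2)) (τ : Fin q → Fin n)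
    (l m : Fin n) :
    pairSum (cnD G) τ l m = (xi2 G τ l m : ℝ) := by
  unfold pairSum cnD xi2
  rw [← Finset.sum_filter, Finset.filter_filter, Finset.sum_const, nsmul_eq_mul, mul_one]
  congr 2
  ext p
  simp only [Finset.mem_filter, and_assoc]

lemma hWeight_wt2vec {q : ℕ} {i j : Fin q} (h : i ≠ j) : hWeight (wt2vec i j) = 2 := by
  unfold hWeight
  refine Eq.trans ?_ (Finset.card_pair h)
  congr 1
  ext r
  simp [wt2vec]
  tauto

lemma chi2_eq_zero {n k q : ℕ} (G : Matrix (Fin k) (Fin q) (ZMod 2)) (τ : Fin q → Fin n)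
    (hd : HasMinDistGE2 G) (h : ¬ HasMinDistEq2 G) (u : ℕ) (l m : Fin n) :
    chi2 G τ u l m = 0 := by
  unfold chi2
  rw [Finset.card_eq_zero, Finset.filter_eq_empty_iff]
  rintro p _ ⟨hne, _, _, x, _, hx⟩
  exact h ⟨hd, x, by rw [hx, hWeight_wt2vec hne]⟩

lemma xi2_eq_zero {n k q : ℕ} (G : Matrix (Fin k) (Fin q) (ZMod 2)) (τ : Fin q → Fin n)
    (hd : HasMinDistGE2 G) (h : ¬ HasMinDistEq2 G) (l m : Fin n) :
    xi2 G τ l m = 0 := by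
  unfold xi2
  rw [Finset.card_eq_zero, Finset.filter_eq_empty_iff]
  rintro p _ ⟨hne, _, _, x, hx⟩
  exact h ⟨hd, x, by rw [hx, hWeight_wt2vec hne]⟩

/-! ### Aggregation -/

lemma IEVagg_hasFDerivAt {n : ℕ} (V : VNSide n) (hV : V.Good) (ε : ℝ) (l : Fin n) :
    HasFDerivAt (fun I => IEVagg V l I ε) (lin fun m => Pmat V ε l m) (fun _ => 1) := by
  have key : ∀ γ ∈ Finset.univ.filter (fun γ => 0 < V.lam γ l),
      HasFDerivAt (fun I => V.lam γ l * IEV (V.vn γ).G (V.vn γ).τ l I ε)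
        (V.lam γ l • lin fun m => (1 / (colCount (V.vn γ).τ l : ℝ)) *
          pairSum (vnD (V.vn γ).G ε) (V.vn γ).τ l m) (fun _ => 1) := by
    intro γ hγ
    have hpos := (V.lam_pos_iff γ l).mp (Finset.mem_filter.mp hγ).2
    simp_rw [IEV_eq_genExit]
    exact (genExit_hasFDerivAt _ _ l _ (vnR_single _ (hV γ).1 (hV γ).2 ε)
      (fun i j _ => vnR_pair _ (hV γ).1 (hV γ).2 ε i j) hpos).const_mul _
  refine (HasFDerivAt.fun_sum key).congr_fderiv ?_
  ext v
  simp only [_root_.sum_apply, _root_.smul_apply, lin_apply, smul_eq_mul, Finset.mul_sum]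
  rw [Finset.sum_comm]
  refine Finset.sum_congr rfl fun m _ => ?_
  unfold Pmat
  rw [Matrix.of_apply, Finset.sum_mul, Finset.sum_filter]
  refine Finset.sum_congr rfl fun γ _ => ?_
  rw [pairSum_vnD]
  by_cases h2 : HasMinDistEq2 (V.vn γ).G
  · rw [if_pos h2]
    split_ifs with hp
    · ring
    · rw [le_antisymm (not_lt.mp hp) (V.lam_nonneg γ l)]; ring
  · rw [if_neg h2]
    simp [chi2_eq_zero _ _ (hV γ).2 h2]

lemma IECagg_hasFDerivAt {n : ℕ} (V : CNSide n) (hV : V.Good) (l : Fin n) :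
    HasFDerivAt (fun I => IECagg V l I) (lin fun m => Cmat V l m) (fun _ => 1) := by
  have key : ∀ γ ∈ Finset.univ.filter (fun γ => 0 < V.rho γ l),
      HasFDerivAt (fun I => V.rho γ l * IEC (V.cn γ).G (V.cn γ).τ l I)
        (V.rho γ l • lin fun m => (1 / (colCount (V.cn γ).τ l : ℝ)) *
          pairSum (cnD (V.cn γ).G) (V.cn γ).τ l m) (fun _ => 1) := by
    intro γ hγ
    have hpos := (V.rho_pos_iff γ l).mp (Finset.mem_filter.mp hγ).2
    simp_rw [IEC_eq_genExit]
    exact (genExit_hasFDerivAt _ _ l _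
      (fun j => by rw [colRank_single _ (hV γ).1 (hV γ).2, colRank_univ _ (hV γ).1])
      (fun i j _ => cnR_pair _ (hV γ).1 (hV γ).2 i j) hpos).const_mul _
  refine (HasFDerivAt.fun_sum key).congr_fderiv ?_
  ext v
  simp only [_root_.sum_apply, _root_.smul_apply, lin_apply, smul_eq_mul, Finset.mul_sum]
  rw [Finset.sum_comm]
  refine Finset.sum_congr rfl fun m _ => ?_
  unfold Cmat
  rw [Matrix.of_apply, Finset.sum_mul, Finset.sum_filter]
  refine Finset.sum_congr rfl fun γ _ => ?_
  rw [pairSum_cnD]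
  by_cases h2 : HasMinDistEq2 (V.cn γ).G
  · rw [if_pos h2]
    split_ifs with hp
    · ring
    · rw [le_antisymm (not_lt.mp hp) (V.rho_nonneg γ l)]; ring
  · rw [if_neg h2]
    simp [xi2_eq_zero _ _ (hV γ).2 h2]

lemma IECagg_one {n : ℕ} (V : CNSide n) (hV : V.Good) (l : Fin n) :
    IECagg V l (fun _ => 1) = 1 := by
  unfold IECagg
  refine Eq.trans ?_ (V.rho_sum l)
  rw [Finset.sum_filter]
  refine Finset.sum_congr rfl fun γ _ => ?_
  split_ifs with hp
  · rw [IEC_eq_genExit, genExit_one, mul_one]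
    intro j
    rw [colRank_single _ (hV γ).1 (hV γ).2, colRank_univ _ (hV γ).1]
  · exact le_antisymm (V.rho_nonneg γ l) (not_lt.mp hp)


lemma exitMap_hasFDerivAt {n : ℕ} (E : Ensemble n)
    (hV : E.toVNSide.Good) (hC : E.toCNSide.Good) (ε : ℝ) (l : Fin n) :
    HasFDerivAt (fun I : Fin n → ℝ => exitMap E ε I l)
      ((lin fun e => Pmat E.toVNSide ε l e).comp
        (ContinuousLinearMap.pi fun e => lin fun m => Cmat E.toCNSide e m)) (fun _ => 1) := by
  have hin : HasFDerivAt (fun I : Fin n → ℝ => fun m => IECagg E.toCNSide m I)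
      (ContinuousLinearMap.pi fun e => lin fun m => Cmat E.toCNSide e m) (fun _ => 1) :=
    hasFDerivAt_pi.mpr fun e => IECagg_hasFDerivAt _ hC e
  have hone : (fun m => IECagg E.toCNSide m (fun _ => 1)) = fun _ => (1 : ℝ) :=
    funext fun m => IECagg_one _ hC m
  have hout := IEVagg_hasFDerivAt E.toVNSide hV ε l
  rw [← hone] at hout
  exact HasFDerivAt.comp (fun _ => 1) hout hin


/-- **Jacobian identity at the erasure-free fixed point.** The EXIT recursion is
differentiable at the all-ones point, and its Jacobian there equals `P(ε) ⬝ C`: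
for all `l, m`, `∂ f_l / ∂ I_m (1) = Σ_e P^{l,e}(ε) C^{e,m}`. -/
theorem jacobian_eq_PC {n : ℕ} (hn : 1 ≤ n) (E : Ensemble n)
    (hV : E.toVNSide.Good) (hC : E.toCNSide.Good)
    (ε : ℝ) (hε : ε ∈ Set.Ioo (0 : ℝ) 1) :
    DifferentiableAt ℝ (exitMap E ε) (fun _ => 1) ∧
    ∀ l m : Fin n,
      fderiv ℝ (fun I : Fin n → ℝ => exitMap E ε I l) (fun _ => 1) (Pi.single m 1)
        = ∑ e : Fin n, Pmat E.toVNSide ε l e * Cmat E.toCNSide e m := by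
  refine ⟨differentiableAt_pi.mpr fun l => (exitMap_hasFDerivAt E hV hC ε l).differentiableAt,
    fun l m => ?_⟩
  rw [(exitMap_hasFDerivAt E hV hC ε l).fderiv]
  simp [lin_apply, Pi.single_apply]
end MET
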